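/- Let q = 16, so that F_q is the field with 16 elements and F_{q^2} the field with 256 elements. There do not exist a ∈ F_q with a ≠ 0, b ∈ F_q, c ∈ F_{q^2} with c ≠ 0, and r ∈ F_{q^2} with r ∉ F_q such that the map from F_q to F_{q^2} sending x to a·x^2 + b·x + c/(x − r) + c^q/(x − r^q) is injective. -/

import Mathlib

/-- Coordinates of an element of the field with 16 elements in the basis `1, g, g², g³`,
where `g⁴ = g + 1`. -/
abbrev Coord : Type := ZMod 2 × ZMod 2 × ZMod 2 × ZMod 2

namespace Coord

/-- Multiplication of coordinate vectors modulo `g⁴ = g + 1`. -/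
def times (v w : Coord) : Coord :=
  (v.1 * w.1 + v.2.1 * w.2.2.2 + v.2.2.1 * w.2.2.1 + v.2.2.2 * w.2.1,
    v.1 * w.2.1 + v.2.1 * w.1 + v.2.1 * w.2.2.2 + v.2.2.1 * w.2.2.1 + v.2.2.2 * w.2.1
      + v.2.2.1 * w.2.2.2 + v.2.2.2 * w.2.2.1,
    v.1 * w.2.2.1 + v.2.1 * w.2.1 + v.2.2.1 * w.1 + v.2.2.1 * w.2.2.2 + v.2.2.2 * w.2.2.1
      + v.2.2.2 * w.2.2.2,
    v.1 * w.2.2.2 + v.2.1 * w.2.2.1 + v.2.2.1 * w.2.1 + v.2.2.2 * w.1 + v.2.2.2 * w.2.2.2)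

/-- The coordinates of `1`. -/
def unit : Coord := (1, 0, 0, 0)

lemma exists_times_eq_unit : ∀ v : Coord, v ≠ 0 → ∃ w, times v w = unit := by
  decide +kernel

/-- The quadratic `x² + x + g³`, which has no roots. -/
def quad (x : Coord) : Coord := times x x + x + (0, 0, 0, 1)

lemma exists_root_or_shift :
    ∀ d : Coord, (∃ x, times x x + x + d = 0) ∨ ∃ v, times v v + v + d = (0, 0, 0, 1) := by
  decide +kernel

lemma exists_times_quad : ∀ b c : Coord, c ≠ 0 → ∃ s x : Coord, s ≠ 0 ∧
    times (times (s + b) (quad x)) (quad (x + s)) = times c (s + unit) := by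
  decide +kernel

variable {F : Type*} [Field F] [CharP F 2]

/-- The element of `F` with given coordinates in the basis `1, g, g², g³`. -/
def eval (g : F) (v : Coord) : F :=
  ZMod.castHom dvd_rfl F v.1 + ZMod.castHom dvd_rfl F v.2.1 * g
    + ZMod.castHom dvd_rfl F v.2.2.1 * g ^ 2 + ZMod.castHom dvd_rfl F v.2.2.2 * g ^ 3

lemma eval_add (g : F) (v w : Coord) : eval g (v + w) = eval g v + eval g w := by
  simp only [eval, Prod.fst_add, Prod.snd_add, map_add]
  ring

lemma eval_unit (g : F) : eval g unit = 1 := by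
  simp [eval, unit]

lemma eval_times {g : F} (hg : g ^ 4 = g + 1) (v w : Coord) :
    eval g (times v w) = eval g v * eval g w := by
  obtain ⟨v0, v1, v2, v3⟩ := v
  obtain ⟨w0, w1, w2, w3⟩ := w
  simp only [eval, times, map_add, map_mul]
  generalize ZMod.castHom dvd_rfl F v0 = v0, ZMod.castHom dvd_rfl F v1 = v1,
    ZMod.castHom dvd_rfl F v2 = v2, ZMod.castHom dvd_rfl F v3 = v3,
    ZMod.castHom dvd_rfl F w0 = w0, ZMod.castHom dvd_rfl F w1 = w1,
    ZMod.castHom dvd_rfl F w2 = w2, ZMod.castHom dvd_rfl F w3 = w3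
  linear_combination -(v1 * w3 + v2 * w2 + v3 * w1 + (v2 * w3 + v3 * w2) * g
    + v3 * w3 * g ^ 2) * hg

lemma eval_zero (g : F) : eval g 0 = 0 := by
  simp [eval]

lemma eval_ne_zero {g : F} (hg : g ^ 4 = g + 1) {v : Coord} (hv : v ≠ 0) : eval g v ≠ 0 := by
  obtain ⟨w, hw⟩ := exists_times_eq_unit v hv
  have h := eval_times hg v w
  rw [hw, eval_unit] at h
  exact left_ne_zero_of_mul (h ▸ one_ne_zero)

lemma eval_surjective [Fintype F] (hF : Fintype.card F = 16) {g : F} (hg : g ^ 4 = g + 1) :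
    Function.Surjective (eval g) := by
  have hinj : Function.Injective (eval g) := by
    intro v w h
    by_contra hne
    apply eval_ne_zero hg (sub_ne_zero.mpr hne)
    have := eval_add g (v - w) w
    rw [sub_add_cancel, h] at this
    exact right_eq_add.mp this
  have hcard : Fintype.card Coord = Fintype.card F := by
    rw [hF]; rfl
  exact ((Fintype.bijective_iff_injective_and_card _).mpr ⟨hinj, hcard⟩).2

end Coord

/-- A primitive 15th root of unity or its inverse is a root of `X⁴ + X + 1`. -/
lemma exists_pow_four_eq {F : Type*} [Field F] [Fintype F] [CharP F 2]
    (hF : Fintype.card F = 16) : ∃ g : F, g ^ 4 = g + 1 := by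
  have h2 : (2 : F) = 0 := CharTwo.two_eq_zero
  classical
  obtain ⟨z, hz⟩ := IsCyclic.exists_ofOrder_eq_natCard (α := Fˣ)
  have hz : orderOf z = 15 := by
    rw [hz, Nat.card_eq_fintype_card, Fintype.card_units, hF]
  have h15 : (z : F) ^ 15 = 1 := by
    rw [← Units.val_pow_eq_pow_val, ← hz, pow_orderOf_eq_one, Units.val_one]
  have hne : ∀ k, 0 < k → k < 15 → (z : F) ^ k - 1 ≠ 0 := by
    intro k hk hk' h
    apply pow_ne_one_of_lt_orderOf hk.ne' (hz ▸ hk' : k < orderOf z)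
    exact Units.ext (by simpa [sub_eq_zero] using h)
  have h3 := hne 3 (by norm_num) (by norm_num)
  have h5 := hne 5 (by norm_num) (by norm_num)
  generalize (z : F) = y at *
  have hy : y ≠ 0 := by rintro rfl; simp at h15
  have hprod : (y ^ 4 + y + 1) * (y ^ 4 + y ^ 3 + 1) = 0 := by
    have h : (y ^ 3 - 1) * (y ^ 5 - 1) * ((y ^ 4 + y + 1) * (y ^ 4 + y ^ 3 + 1)) = 0 := by
      linear_combination (y + 1) * h15
        + (1 + y + y ^ 4 - y ^ 6 - y ^ 7 - y ^ 9 - y ^ 10 + y ^ 12) * h2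
    exact (mul_eq_zero.mp h).resolve_left (mul_ne_zero h3 h5)
  rcases mul_eq_zero.mp hprod with h | h
  · exact ⟨y, by linear_combination h - (y + 1) * h2⟩
  · refine ⟨y⁻¹, ?_⟩
    field_simp
    linear_combination -h + h2

lemma exists_quadratic_collision {F : Type*} [Field F] [Fintype F] [CharP F 2]
    (hF : Fintype.card F = 16) (b : F) {c d : F} (hc : c ≠ 0)
    (hd : ∀ x : F, x ^ 2 + x + d ≠ 0) :
    ∃ x s : F, s ≠ 0 ∧
      (s + b) * (x ^ 2 + x + d) * ((x + s) ^ 2 + (x + s) + d) = c * (s + 1) := by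
  have h2 : (2 : F) = 0 := CharTwo.two_eq_zero
  obtain ⟨g, hg⟩ := exists_pow_four_eq hF
  have hsurj := Coord.eval_surjective hF hg
  obtain ⟨b, rfl⟩ := hsurj b
  obtain ⟨c, rfl⟩ := hsurj c
  obtain ⟨d, rfl⟩ := hsurj d
  have hc' : c ≠ 0 := by rintro rfl; exact hc (Coord.eval_zero g)
  rcases Coord.exists_root_or_shift d with ⟨x, hx⟩ | ⟨v, hv⟩
  · refine absurd ?_ (hd (Coord.eval g x))
    have := congrArg (Coord.eval g) hx
    rwa [Coord.eval_add, Coord.eval_add, Coord.eval_times hg, Coord.eval_zero, ← sq] at this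
  · obtain ⟨s, x, hs, h⟩ := Coord.exists_times_quad b c hc'
    have hq (y : Coord) : Coord.eval g (Coord.quad y) = (Coord.eval g y + Coord.eval g v) ^ 2
        + (Coord.eval g y + Coord.eval g v) + Coord.eval g d := by
      rw [Coord.quad, ← hv]
      simp only [Coord.eval_add, Coord.eval_times hg]
      linear_combination -Coord.eval g y * Coord.eval g v * h2
    refine ⟨Coord.eval g x + Coord.eval g v, Coord.eval g s, Coord.eval_ne_zero hg hs, ?_⟩
    have := congrArg (Coord.eval g) h
    simp only [Coord.eval_times hg, Coord.eval_add, hq, Coord.eval_unit] at this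
    linear_combination this

lemma not_injective_quadratic_add_div {F : Type*} [Field F] [Fintype F] [CharP F 2]
    (hF : Fintype.card F = 16) {a b c t n : F} (ha : a ≠ 0) (hc : c ≠ 0) (ht : t ≠ 0)
    (hn : ∀ x : F, x ^ 2 + t * x + n ≠ 0) :
    ¬ Function.Injective fun x : F => a * x ^ 2 + b * x + c / (x ^ 2 + t * x + n) := by
  have h2 : (2 : F) = 0 := CharTwo.two_eq_zero
  obtain ⟨x, s, hs, h⟩ := exists_quadratic_collision hF (b / (a * t))
    (c := c / (a * t ^ 4)) (d := n / t ^ 2) (by positivity) (fun x hx => hn (t * x) (by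
      field_simp at hx
      linear_combination hx))
  intro hinj
  field_simp at h
  have hdiv : c / ((t * x) ^ 2 + t * (t * x) + n)
      - c / ((t * (x + s)) ^ 2 + t * (t * (x + s)) + n) = t * s * (a * t * s + b) := by
    rw [div_sub_div _ _ (hn _) (hn _), div_eq_iff (mul_ne_zero (hn _) (hn _))]
    linear_combination -t * s * h + c * t ^ 2 * x * s * h2
  have := @hinj (t * x) (t * (x + s)) (by
    linear_combination hdiv - a * t ^ 2 * x * s * h2)
  apply hs
  simpa [ht] using this

lemma splits_X_pow_card_sub_X {F : Type*} [Field F] [Fintype F] :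
    (Polynomial.X ^ Fintype.card F - Polynomial.X : Polynomial F).Splits := by
  rw [Polynomial.splits_iff_card_roots, FiniteField.roots_X_pow_card_sub_X,
    FiniteField.X_pow_card_sub_X_natDegree_eq _ Fintype.one_lt_card]
  rfl

lemma mem_range_algebraMap_iff_pow_card {F K : Type*} [Field F] [Fintype F] [Field K]
    [Algebra F K] {z : K} : z ∈ Set.range (algebraMap F K) ↔ z ^ Fintype.card F = z := by
  constructor
  · rintro ⟨x, rfl⟩
    rw [← map_pow, FiniteField.pow_card]
  · intro hz
    refine splits_X_pow_card_sub_X.mem_range_of_isRoot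
      (FiniteField.X_pow_card_sub_X_ne_zero _ Fintype.one_lt_card) (x := z) ?_
    simp [hz]

lemma sum_inv_sub_algebraMap {F K : Type*} [Field F] [Fintype F] [Field K] [Algebra F K]
    {z : K} (hz : z ∉ Set.range (algebraMap F K)) :
    ∑ x : F, 1 / (z - algebraMap F K x) = -1 / (z ^ Fintype.card F - z) := by
  have hs := splits_X_pow_card_sub_X (F := F)
  have hz' : z ^ Fintype.card F - z ≠ 0 :=
    sub_ne_zero.mpr (mt mem_range_algebraMap_iff_pow_card.mpr hz)
  have h := (hs.map (algebraMap F K)).eval_derivative_div_eval_of_ne_zero (x := z)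
    (by simpa using hz')
  have hc : (Fintype.card F : K) = 0 := by
    rw [← map_natCast (algebraMap F K), FiniteField.cast_card_eq_zero, map_zero]
  rw [hs.roots_map, FiniteField.roots_X_pow_card_sub_X] at h
  simpa [hc, Polynomial.derivative_X_pow] using h.symm

/-- For `q = 16`, there are no `a ∈ F_q*`, `b ∈ F_q`, `c ∈ F_{q²}*`, `r ∈ F_{q²} \ F_q`
such that `x ↦ a·x² + b·x + c/(x - r) + c^q/(x - r^q)` is injective on `F_q`. -/
theorem stmt_19 (F K : Type*) [Field F] [Fintype F] [Field K] [Fintype K] [Algebra F K]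
    (hF : Fintype.card F = 16) (hK : Fintype.card K = 256) :
    ¬ ∃ (a b : F) (c r : K), a ≠ 0 ∧ c ≠ 0 ∧ r ∉ Set.range (algebraMap F K) ∧
      Function.Injective fun x : F =>
        algebraMap F K (a * x ^ 2 + b * x) + c / (algebraMap F K x - r)
          + c ^ 16 / (algebraMap F K x - r ^ 16) := by
  rintro ⟨a, b, c, r, ha, hc, hr, hinj⟩
  have : Fact (Nat.Prime 2) := ⟨Nat.prime_two⟩
  have : CharP F 2 := charP_of_card_eq_prime_pow (f := 4) hF
  have : CharP K 2 := charP_of_card_eq_prime_pow (f := 8) hK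
  have h2 : (2 : K) = 0 := CharTwo.two_eq_zero
  have hmem (z : K) : z ∈ Set.range (algebraMap F K) ↔ z ^ 16 = z := by
    rw [mem_range_algebraMap_iff_pow_card, hF]
  have hadd (u v : K) : (u + v) ^ 16 = u ^ 16 + v ^ 16 := add_pow_char_pow u v (p := 2) (n := 4)
  have hsub (u v : K) : (u - v) ^ 16 = u ^ 16 - v ^ 16 := sub_pow_char_pow u v (p := 2) (n := 4)
  have hpow (z : K) : (z ^ 16) ^ 16 = z := by
    simpa only [← pow_mul, hK] using FiniteField.pow_card z
  have halg (x : F) : algebraMap F K x ^ 16 = algebraMap F K x := (hmem _).mp ⟨x, rfl⟩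
  have hr' : r ^ 16 ∉ Set.range (algebraMap F K) := by
    rw [hmem, hpow]
    exact fun h => hr ((hmem r).mpr h.symm)
  have hrr : r ^ 16 - r ≠ 0 := sub_ne_zero.mpr (mt (hmem r).mpr hr)
  have hne {z : K} (hz : z ∉ Set.range (algebraMap F K)) (x : F) : algebraMap F K x - z ≠ 0 :=
    fun h => hz ⟨x, sub_eq_zero.mp h⟩
  have hval (x : F) : ∃ y : F, algebraMap F K y = algebraMap F K (a * x ^ 2 + b * x)
      + c / (algebraMap F K x - r) + c ^ 16 / (algebraMap F K x - r ^ 16) := by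
    refine (hmem _).mpr ?_
    rw [hadd, hadd, div_pow, div_pow, hsub, hsub, hpow, hpow, halg, halg]
    ring
  choose h hh using hval
  simp only [← hh] at hinj
  have hbij : Function.Bijective h := Finite.injective_iff_bijective.mp hinj.of_comp
  have hsum1 : ∑ x : F, x = 0 := by
    simpa using FiniteField.sum_pow_lt_card_sub_one F 1 (by simp [hF])
  have hsum2 : ∑ x : F, x ^ 2 = 0 := FiniteField.sum_pow_lt_card_sub_one F 2 (by simp [hF])
  have hpoly : ∑ x : F, (a * x ^ 2) + ∑ x : F, b * x = 0 := by
    rw [← Finset.mul_sum, ← Finset.mul_sum, hsum1, hsum2, mul_zero, mul_zero, add_zero]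
  have hcc : c ^ 16 = c := by
    have hsum : ∑ x : F, algebraMap F K (h x) = 0 := by
      rw [← map_sum, hbij.sum_comp (fun x => x), hsum1, map_zero]
    have hinv (e z : K) (hz : z ∉ Set.range (algebraMap F K)) :
        ∑ x : F, e / (algebraMap F K x - z) = e / (z ^ 16 - z) := by
      have := sum_inv_sub_algebraMap hz
      rw [hF] at this
      calc ∑ x : F, e / (algebraMap F K x - z)
          = -e * ∑ x : F, 1 / (z - algebraMap F K x) := by
            rw [Finset.mul_sum]
            refine Finset.sum_congr rfl fun x _ => ?_
            rw [← neg_sub z, div_neg, mul_one_div, neg_div]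
        _ = e / (z ^ 16 - z) := by rw [this]; ring
    simp only [hh, Finset.sum_add_distrib, hinv _ _ hr, hinv _ _ hr', hpow, ← map_sum,
      hpoly, map_zero, zero_add] at hsum
    rw [← neg_sub (r ^ 16), div_neg, ← sub_eq_add_neg, ← sub_div, div_eq_zero_iff] at hsum
    exact (sub_eq_zero.mp (hsum.resolve_right hrr)).symm
  obtain ⟨c, rfl⟩ := (hmem c).mpr hcc
  obtain ⟨t, ht⟩ := (hmem (r + r ^ 16)).mpr (by rw [hadd, hpow, add_comm])
  obtain ⟨n, hn⟩ := (hmem (r * r ^ 16)).mpr (by rw [mul_pow, hpow, mul_comm])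
  have hquad (x : F) : algebraMap F K (x ^ 2 + t * x + n)
      = (algebraMap F K x - r) * (algebraMap F K x - r ^ 16) := by
    simp only [map_add, map_mul, map_pow, ht, hn]
    linear_combination (r + r ^ 16) * algebraMap F K x * h2
  have ht0 : t ≠ 0 := by
    rintro rfl
    apply hrr
    rw [map_zero] at ht
    linear_combination -ht - r * h2
  have hn0 (x : F) : x ^ 2 + t * x + n ≠ 0 := by
    rw [← map_ne_zero (algebraMap F K), hquad]
    exact mul_ne_zero (hne hr x) (hne hr' x)
  refine not_injective_quadratic_add_div hF (b := b) ha
    (mul_ne_zero ((map_ne_zero _).mp hc) ht0) ht0 hn0 ?_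
  convert hbij.injective using 1
  funext x
  apply (algebraMap F K).injective
  have h1 := hne hr x
  have h3 := hne hr' x
  rw [hh, hcc, map_add, map_div₀, hquad, map_mul _ c, ht]
  field_simp
  linear_combination -algebraMap F K c * (algebraMap F K x - r - r ^ 16) * h2
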